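/- Let (M^{2n+1},φ,ξ,η,g) be a contact metric manifold and let ∇̃ be the connection defined by ∇̃_Z Z' = (∇̂_Z Z')_D, ∇̃_ξ Z = [ξ,Z], ∇̃ξ = 0 for sections Z,Z' of the contact distribution D, where ∇̂ is the Levi-Civita connection and (·)_D denotes projection onto D. Then: (M^{2n+1},φ,ξ,η,g) is K-contact if and only if ∇̃g = 0; and (M^{2n+1},φ,ξ,η,g) is Sasakian if and only if ∇̃φ = 0, in which case ∇̃ coincides with the Tanaka-Webster connection of (M^{2n+1},φ,ξ,η,g). -/

import Mathlib

/-!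
Abstract framework for the calculus of smooth vector fields on a smooth
manifold `M`.  The commutative `ℝ`-algebra `F` plays the role of the ring
`C^∞(M)` of smooth real-valued functions, and the `F`-module `V` plays the
role of the `C^∞(M)`-module of smooth vector fields, together with the
action of vector fields on functions by derivations and the Lie bracket of
vector fields.
-/

structure VFCalculus (F V : Type*) [CommRing F] [Algebra ℝ F]
    [AddCommGroup V] [Module F V] where
  act : V → F → F
  act_add_left : ∀ X Y f, act (X + Y) f = act X f + act Y f
  act_smul_left : ∀ (f : F) (X : V) (g : F), act (f • X) g = f * act X g
  act_add_right : ∀ X f g, act X (f + g) = act X f + act X g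
  act_mul_right : ∀ X f g, act X (f * g) = act X f * g + f * act X g
  act_const : ∀ X (r : ℝ), act X (algebraMap ℝ F r) = 0
  bracket : V → V → V
  bracket_antisymm : ∀ X Y, bracket X Y = - bracket Y X
  bracket_add_left : ∀ X Y Z, bracket (X + Y) Z = bracket X Z + bracket Y Z
  bracket_smul_right : ∀ (f : F) (X Y : V),
    bracket X (f • Y) = act X f • Y + f • bracket X Y
  act_bracket : ∀ X Y f, act (bracket X Y) f = act X (act Y f) - act Y (act X f)
  jacobi : ∀ X Y Z,
    bracket X (bracket Y Z) + bracket Y (bracket Z X) + bracket Z (bracket X Y) = 0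

variable {F V : Type*} [CommRing F] [Algebra ℝ F] [AddCommGroup V] [Module F V]

/-- A linear (Koszul) connection on the tangent bundle. -/
def VFCalculus.IsConnection (C : VFCalculus F V) (D : V → V → V) : Prop :=
  (∀ X Y Z, D (X + Y) Z = D X Z + D Y Z) ∧
  (∀ (f : F) (X Y : V), D (f • X) Y = f • D X Y) ∧
  (∀ X Y Z, D X (Y + Z) = D X Y + D X Z) ∧
  (∀ (f : F) (X Y : V), D X (f • Y) = C.act X f • Y + f • D X Y)

/-- The torsion tensor of a connection. -/
def VFCalculus.torsion (C : VFCalculus F V) (D : V → V → V) (X Y : V) : V :=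
  D X Y - D Y X - C.bracket X Y

/-- The curvature tensor of a connection. -/
def VFCalculus.curvature (C : VFCalculus F V) (D : V → V → V) (X Y Z : V) : V :=
  D X (D Y Z) - D Y (D X Z) - D (C.bracket X Y) Z

/-- A contact form `η` on an odd-dimensional manifold, together with its Reeb
vector field `ξ`: `η(ξ) = 1`, `dη(ξ,·) = 0`, and `dη` is nondegenerate on the
contact distribution `D = ker η` (this encodes `η ∧ (dη)ⁿ ≠ 0`). -/
structure ContactForm (C : VFCalculus F V) where
  η : V → F
  η_add : ∀ X Y, η (X + Y) = η X + η Y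
  η_smul : ∀ (f : F) (X : V), η (f • X) = f * η X
  ξ : V
  η_ξ : η ξ = 1
  dη_ξ : ∀ X, C.act ξ (η X) = η (C.bracket ξ X)
  nondeg : ∀ X, η X = 0 →
    (∀ Y, η Y = 0 → C.act X (η Y) - C.act Y (η X) - η (C.bracket X Y) = 0) → X = 0

/-- The exterior differential of the contact form, with the convention
`2 u ∧ v = u ⊗ v - v ⊗ u`, so that
`dη(X,Y) = (1/2) (X(η Y) - Y(η X) - η [X,Y])`. -/
noncomputable def dEta (C : VFCalculus F V) (S : ContactForm C) (X Y : V) : F :=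
  algebraMap ℝ F (1 / 2) * (C.act X (S.η Y) - C.act Y (S.η X) - S.η (C.bracket X Y))

/-- A Legendrian distribution: an `n`-dimensional subbundle of the contact
distribution on which `dη` vanishes; `n`-dimensionality is encoded as maximal
isotropy of each fibre inside the symplectic vector space `(ker η, dη)`. -/
def IsLegendrian (C : VFCalculus F V) (S : ContactForm C) (L : Submodule F V) : Prop :=
  (∀ X ∈ L, S.η X = 0) ∧
  (∀ X ∈ L, ∀ Y ∈ L, dEta C S X Y = 0) ∧
  (∀ X, S.η X = 0 → (∀ Y ∈ L, dEta C S X Y = 0) → X ∈ L)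

/-- A distribution is flat when `[ξ, X] ∈ Γ(L)` for all `X ∈ Γ(L)`. -/
def IsFlatDistrib (C : VFCalculus F V) (S : ContactForm C) (L : Submodule F V) : Prop :=
  ∀ X ∈ L, C.bracket S.ξ X ∈ L

/-- A distribution is integrable when it is stable under the Lie bracket. -/
def IsIntegrableDistrib (C : VFCalculus F V) (L : Submodule F V) : Prop :=
  ∀ X ∈ L, ∀ Y ∈ L, C.bracket X Y ∈ L

/-- The data of an almost bi-Legendrian structure: the two (Legendrian)
distributions `L₁`, `L₂` are transversal, i.e. `TM = L₁ ⊕ L₂ ⊕ ℝξ`, as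
expressed by the associated projection operators `p1`, `p2`. -/
structure BiLegProj (C : VFCalculus F V) (S : ContactForm C)
    (L1 L2 : Submodule F V) where
  p1 : V →ₗ[F] V
  p2 : V →ₗ[F] V
  p1_mem : ∀ X, p1 X ∈ L1
  p2_mem : ∀ X, p2 X ∈ L2
  decomp : ∀ X, X = p1 X + p2 X + S.η X • S.ξ
  p1_of_mem1 : ∀ X ∈ L1, p1 X = X
  p2_of_mem2 : ∀ Y ∈ L2, p2 Y = Y
  p1_of_mem2 : ∀ Y ∈ L2, p1 Y = 0
  p2_of_mem1 : ∀ X ∈ L1, p2 X = 0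
  p1_ξ : p1 S.ξ = 0
  p2_ξ : p2 S.ξ = 0

/-- The characterizing properties of the bi-Legendrian connection of an almost
bi-Legendrian manifold `(M, η, L₁, L₂)`:  it preserves `L₁`, `L₂` and `ℝξ`,
it parallelizes `dη`, and its torsion satisfies `T(X,Y) = 2dη(X,Y)ξ` for
`X ∈ Γ(L₁)`, `Y ∈ Γ(L₂)` and
`T(V,ξ) = [ξ, V_{L₁}]_{L₂} + [ξ, V_{L₂}]_{L₁}` for all `V`. -/
def IsBiLegConnection (C : VFCalculus F V) (S : ContactForm C)
    (L1 L2 : Submodule F V) (B : BiLegProj C S L1 L2) (D : V → V → V) : Prop :=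
  C.IsConnection D ∧
  (∀ U X, X ∈ L1 → D U X ∈ L1) ∧
  (∀ U Y, Y ∈ L2 → D U Y ∈ L2) ∧
  (∀ U, D U S.ξ ∈ Submodule.span F {S.ξ}) ∧
  (∀ U X Y, C.act U (dEta C S X Y) = dEta C S (D U X) Y + dEta C S X (D U Y)) ∧
  (∀ X ∈ L1, ∀ Y ∈ L2, C.torsion D X Y = (2 * dEta C S X Y) • S.ξ) ∧
  (∀ W, C.torsion D W S.ξ =
    B.p2 (C.bracket S.ξ (B.p1 W)) + B.p1 (C.bracket S.ξ (B.p2 W)))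

/-- A contact metric structure `(φ, ξ, η, g)`. -/
structure ContactMetric (C : VFCalculus F V) extends ContactForm C where
  φ : V →ₗ[F] V
  g : V → V → F
  g_symm : ∀ X Y, g X Y = g Y X
  g_add_left : ∀ X Y Z, g (X + Y) Z = g X Z + g Y Z
  g_smul_left : ∀ (f : F) (X Y : V), g (f • X) Y = f * g X Y
  φ_sq : ∀ X, φ (φ X) = -X + η X • ξ
  φ_ξ : φ ξ = 0
  η_φ : ∀ X, η (φ X) = 0
  g_ξ : ∀ X, g X ξ = η X
  compat : ∀ X Y, dEta C toContactForm X Y = g X (φ Y)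

/-- The tensor field `h = (1/2) L_ξ φ`. -/
noncomputable def hTensor (C : VFCalculus F V) (M : ContactMetric C) (X : V) : V :=
  algebraMap ℝ F (1 / 2) • (C.bracket M.ξ (M.φ X) - M.φ (C.bracket M.ξ X))

/-- The Lie derivative of the metric: `(L_X g)(Y,Z)`. -/
def lieDerivG (C : VFCalculus F V) (M : ContactMetric C) (X Y Z : V) : F :=
  C.act X (M.g Y Z) - M.g (C.bracket X Y) Z - M.g Y (C.bracket X Z)

/-- `g` is bundle-like with respect to the distribution `E`:
`(L_Z g)(Y,Y') = 0` whenever `Z` is a section of `E` and `Y`, `Y'` are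
sections of the `g`-orthogonal complement of `E`. -/
def IsBundleLike (C : VFCalculus F V) (M : ContactMetric C) (E : Submodule F V) : Prop :=
  ∀ Z ∈ E, ∀ Y Y' : V, (∀ U ∈ E, M.g Y U = 0) → (∀ U ∈ E, M.g Y' U = 0) →
    lieDerivG C M Z Y Y' = 0

/-- `∇ g = 0`. -/
def MetricCompat (C : VFCalculus F V) (M : ContactMetric C) (D : V → V → V) : Prop :=
  ∀ U X Y, C.act U (M.g X Y) = M.g (D U X) Y + M.g X (D U Y)

/-- `∇ φ = 0`. -/
def PhiCompat (C : VFCalculus F V) (M : ContactMetric C) (D : V → V → V) : Prop :=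
  ∀ U X, D U (M.φ X) = M.φ (D U X)

/-- `∇ η = 0`. -/
def EtaCompat (C : VFCalculus F V) (S : ContactForm C) (D : V → V → V) : Prop :=
  ∀ U X, C.act U (S.η X) = S.η (D U X)

/-- `D` is the Levi-Civita connection of `g`: the unique torsion-free metric
connection. -/
def IsLeviCivita (C : VFCalculus F V) (M : ContactMetric C) (D : V → V → V) : Prop :=
  C.IsConnection D ∧ (∀ X Y, C.torsion D X Y = 0) ∧ MetricCompat C M D

/-- The Sasakian condition, written via the Levi-Civita connection `lc`:
`(∇̂_V φ) W = g(V,W) ξ - η(W) V`. -/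
def IsSasakian (C : VFCalculus F V) (M : ContactMetric C) (lc : V → V → V) : Prop :=
  ∀ X Y, lc X (M.φ Y) - M.φ (lc X Y) = M.g X Y • M.ξ - M.η Y • X

/-- K-contact: the Reeb vector field is Killing. -/
def IsKContact (C : VFCalculus F V) (M : ContactMetric C) : Prop :=
  ∀ Y Z, lieDerivG C M M.ξ Y Z = 0

/-- The generalized Tanaka-Webster connection of a contact metric manifold:
`*∇_V W = ∇̂_V W + η(V) φW + η(W)(φV + φhV) + dη(V + hV, W) ξ`. -/
noncomputable def tanakaWebster (C : VFCalculus F V) (M : ContactMetric C) (lc : V → V → V)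
    (X Y : V) : V :=
  lc X Y + M.η X • M.φ Y + M.η Y • (M.φ X + M.φ (hTensor C M X)) +
    dEta C M.toContactForm (X + hTensor C M X) Y • M.ξ

/-- A symplectic form on an (abstract) even-dimensional manifold. -/
structure SymplForm (C : VFCalculus F V) where
  ω : V → V → F
  ω_add_left : ∀ X Y Z, ω (X + Y) Z = ω X Z + ω Y Z
  ω_smul_left : ∀ (f : F) (X Y : V), ω (f • X) Y = f * ω X Y
  ω_antisymm : ∀ X Y, ω X Y = - ω Y X
  closed : ∀ X Y Z,
    C.act X (ω Y Z) - C.act Y (ω X Z) + C.act Z (ω X Y) -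
      ω (C.bracket X Y) Z + ω (C.bracket X Z) Y - ω (C.bracket Y Z) X = 0
  nondeg : ∀ X, (∀ Y, ω X Y = 0) → X = 0

/-- A Lagrangian distribution: an `n`-dimensional subbundle on which `ω`
vanishes; `n`-dimensionality is encoded as fibrewise maximal isotropy. -/
def IsLagrangian (C : VFCalculus F V) (S : SymplForm C) (L : Submodule F V) : Prop :=
  (∀ X ∈ L, ∀ Y ∈ L, S.ω X Y = 0) ∧
  (∀ X, (∀ Y ∈ L, S.ω X Y = 0) → X ∈ L)

/-- The characterizing properties of the bi-Lagrangian (Hess) connection of a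
pair of transversal Lagrangian distributions: the unique symplectic connection
preserving both distributions with `T(X,Y) = 0` for `X ∈ Γ(L₁)`, `Y ∈ Γ(L₂)`. -/
def IsBiLagConnection (C : VFCalculus F V) (S : SymplForm C)
    (L1 L2 : Submodule F V) (D : V → V → V) : Prop :=
  C.IsConnection D ∧
  (∀ U X Y, C.act U (S.ω X Y) = S.ω (D U X) Y + S.ω X (D U Y)) ∧
  (∀ U X, X ∈ L1 → D U X ∈ L1) ∧
  (∀ U Y, Y ∈ L2 → D U Y ∈ L2) ∧
  (∀ X ∈ L1, ∀ Y ∈ L2, C.torsion D X Y = 0)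

namespace VFCalculus

variable (C : VFCalculus F V)

lemma act_zero_right (X : V) : C.act X 0 = 0 := by
  simpa using C.act_const X 0

lemma act_one_right (X : V) : C.act X 1 = 0 := by
  simpa using C.act_const X 1

lemma act_neg_right (X : V) (f : F) : C.act X (-f) = -C.act X f := by
  have h := C.act_add_right X f (-f)
  rw [add_neg_cancel, act_zero_right] at h
  linear_combination -h

lemma act_sub_right (X : V) (f g : F) : C.act X (f - g) = C.act X f - C.act X g := by
  rw [sub_eq_add_neg, act_add_right, act_neg_right, sub_eq_add_neg]

lemma act_algebraMap_mul (X : V) (r : ℝ) (f : F) :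
    C.act X (algebraMap ℝ F r * f) = algebraMap ℝ F r * C.act X f := by
  rw [act_mul_right, act_const, zero_mul, zero_add]

lemma bracket_add_right (X Y Z : V) :
    C.bracket X (Y + Z) = C.bracket X Y + C.bracket X Z := by
  rw [C.bracket_antisymm X, bracket_add_left, C.bracket_antisymm X Y, C.bracket_antisymm X Z]
  abel

end VFCalculus

lemma two_mul_algebraMap_half : (2 : F) * algebraMap ℝ F (1 / 2) = 1 := by
  rw [← map_ofNat (algebraMap ℝ F) 2, ← map_mul]
  norm_num

lemma eq_zero_of_two_mul_eq_zero {f : F} (h : 2 * f = 0) : f = 0 := by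
  linear_combination algebraMap ℝ F (1 / 2) * h - f * two_mul_algebraMap_half (F := F)

lemma VFCalculus.bracket_self (C : VFCalculus F V) (X : V) : C.bracket X X = 0 := by
  have h : (2 : F) • C.bracket X X = 0 := by
    rw [two_smul]
    nth_rewrite 1 [C.bracket_antisymm X X]
    exact neg_add_cancel _
  rw [← one_smul F (C.bracket X X), ← two_mul_algebraMap_half (F := F), mul_comm, mul_smul, h,
    smul_zero]

namespace VFCalculus.IsConnection

variable {C : VFCalculus F V} {D : V → V → V} (hD : C.IsConnection D)
include hD

lemma zero_right (X : V) : D X 0 = 0 := by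
  simpa using hD.2.2.1 X 0 0

end VFCalculus.IsConnection

namespace ContactForm

variable {C : VFCalculus F V} (S : ContactForm C)

lemma η_zero : S.η 0 = 0 := by
  simpa using S.η_smul 0 0

lemma η_neg (X : V) : S.η (-X) = -S.η X := by
  simpa using S.η_smul (-1) X

lemma η_sub (X Y : V) : S.η (X - Y) = S.η X - S.η Y := by
  rw [sub_eq_add_neg, η_add, η_neg, sub_eq_add_neg]

lemma exists_horizontal_add_smul (X : V) :
    ∃ Z, S.η Z = 0 ∧ ∃ f : F, X = Z + f • S.ξ :=
  ⟨X - S.η X • S.ξ, by rw [η_sub, η_smul, η_ξ, mul_one, sub_self], S.η X, by abel⟩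

lemma η_bracket_ξ {X : V} (hX : S.η X = 0) : S.η (C.bracket S.ξ X) = 0 := by
  rw [← S.dη_ξ, hX, C.act_zero_right]

lemma dEta_antisymm (X Y : V) : dEta C S X Y = -dEta C S Y X := by
  unfold dEta
  rw [C.bracket_antisymm X Y, η_neg]
  ring

/-- The Lie derivative of `dη` along the Reeb vector field vanishes. -/
lemma act_ξ_dEta (X Y : V) :
    C.act S.ξ (dEta C S X Y) =
      dEta C S (C.bracket S.ξ X) Y + dEta C S X (C.bracket S.ξ Y) := by
  unfold dEta
  have hj : S.η (C.bracket S.ξ (C.bracket X Y)) =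
      S.η (C.bracket (C.bracket S.ξ X) Y) + S.η (C.bracket X (C.bracket S.ξ Y)) := by
    have h := congrArg S.η (C.jacobi S.ξ X Y)
    rw [S.η_add, S.η_add, S.η_zero, C.bracket_antisymm Y (C.bracket S.ξ X),
      C.bracket_antisymm Y S.ξ, S.η_neg, ← neg_one_smul F (C.bracket S.ξ Y),
      C.bracket_smul_right, S.η_add, S.η_smul, S.η_smul] at h
    have h1 : C.act X (-1) = 0 := by rw [C.act_neg_right, C.act_one_right, neg_zero]
    rw [h1] at h
    linear_combination h
  rw [C.act_algebraMap_mul, C.act_sub_right, C.act_sub_right, C.act_bracket, C.act_bracket,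
    S.dη_ξ (C.bracket X Y), hj, S.dη_ξ X, S.dη_ξ Y]
  ring

end ContactForm

namespace ContactMetric

variable {C : VFCalculus F V} (M : ContactMetric C)

lemma g_add_right (X Y Z : V) : M.g X (Y + Z) = M.g X Y + M.g X Z := by
  rw [M.g_symm, M.g_add_left, M.g_symm Y, M.g_symm Z]

lemma g_smul_right (f : F) (X Y : V) : M.g X (f • Y) = f * M.g X Y := by
  rw [M.g_symm, M.g_smul_left, M.g_symm Y]

lemma g_neg_left (X Y : V) : M.g (-X) Y = -M.g X Y := by
  simpa using M.g_smul_left (-1) X Y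

lemma g_neg_right (X Y : V) : M.g X (-Y) = -M.g X Y := by
  simpa using M.g_smul_right (-1) X Y

lemma g_sub_left (X Y Z : V) : M.g (X - Y) Z = M.g X Z - M.g Y Z := by
  rw [sub_eq_add_neg, g_add_left, g_neg_left, sub_eq_add_neg]

lemma g_sub_right (X Y Z : V) : M.g X (Y - Z) = M.g X Y - M.g X Z := by
  rw [sub_eq_add_neg, g_add_right, g_neg_right, sub_eq_add_neg]

lemma g_ξ_left (X : V) : M.g M.ξ X = M.η X := by
  rw [M.g_symm, M.g_ξ]

lemma g_φ_left (X Y : V) : M.g (M.φ X) Y = -M.g X (M.φ Y) := by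
  rw [M.g_symm, ← M.compat, ← M.compat, M.dEta_antisymm]

lemma g_φ_φ (X Y : V) : M.g (M.φ X) (M.φ Y) = M.g X Y - M.η X * M.η Y := by
  rw [g_φ_left, φ_sq, g_add_right, g_neg_right, g_smul_right, g_ξ]
  ring

lemma eq_zero_of_forall_g_eq_zero {X : V} (h : ∀ Y, M.g X Y = 0) : X = 0 := by
  have hX : M.η X = 0 := by rw [← M.g_ξ, h]
  refine M.nondeg X hX fun Y _ => ?_
  have hc := M.compat X Y
  rw [h] at hc
  unfold dEta at hc
  linear_combination 2 * hc - (C.act X (M.η Y) - C.act Y (M.η X) - M.η (C.bracket X Y)) *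
    two_mul_algebraMap_half (F := F)

lemma φ_add_smul_ξ (X : V) (f : F) : M.φ (X + f • M.ξ) = M.φ X := by
  rw [map_add, map_smul, M.φ_ξ, smul_zero, add_zero]

lemma lieDerivG_ξ_add_smul (X Y : V) (f k : F) :
    lieDerivG C M M.ξ (X + f • M.ξ) (Y + k • M.ξ) = lieDerivG C M M.ξ X Y := by
  simp only [lieDerivG, g_add_left, g_add_right, g_smul_left, g_smul_right, g_ξ, g_ξ_left,
    C.bracket_add_right, C.bracket_smul_right, C.bracket_self, C.act_add_right, C.act_mul_right,
    smul_zero, add_zero, M.dη_ξ]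
  ring

/-- If `φ` is invariant under the Reeb flow then `ξ` is a Killing vector field. -/
lemma isKContact_of_bracket_ξ_φ
    (h : ∀ Z, M.η Z = 0 → C.bracket M.ξ (M.φ Z) = M.φ (C.bracket M.ξ Z)) :
    IsKContact C M := by
  intro X Y
  obtain ⟨Z, hZ, f, rfl⟩ := M.exists_horizontal_add_smul X
  obtain ⟨W, hW, k, rfl⟩ := M.exists_horizontal_add_smul Y
  rw [lieDerivG_ξ_add_smul]
  have hφ : W = M.φ (-M.φ W) := by
    rw [map_neg, M.φ_sq, hW, zero_smul, add_zero, neg_neg]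
  rw [hφ]
  have hη : M.η (-M.φ W) = 0 := by rw [M.η_neg, M.η_φ, neg_zero]
  have hL := M.act_ξ_dEta Z (-M.φ W)
  rw [M.compat, M.compat, M.compat, ← h _ hη] at hL
  unfold lieDerivG
  linear_combination hL

section LeviCivita

variable {M} {lc : V → V → V} (hlc : IsLeviCivita C M lc)
include hlc

lemma bracket_eq_sub (X Y : V) : C.bracket X Y = lc X Y - lc Y X := by
  rw [← sub_eq_zero, ← neg_eq_zero, neg_sub]
  exact hlc.2.1 X Y

lemma η_lc_ξ (X : V) : M.η (lc X M.ξ) = 0 := by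
  have h := hlc.2.2 X M.ξ M.ξ
  rw [M.g_ξ, M.η_ξ, C.act_one_right, M.g_ξ_left, M.g_ξ] at h
  exact eq_zero_of_two_mul_eq_zero (by linear_combination -h)

lemma η_lc (X : V) {Y : V} (hY : M.η Y = 0) : M.η (lc X Y) = -M.g Y (lc X M.ξ) := by
  have h := hlc.2.2 X Y M.ξ
  rw [M.g_ξ, M.g_ξ, hY, C.act_zero_right] at h
  linear_combination -h

/-- On a K-contact manifold `∇ξ = -φ`. -/
lemma lc_ξ_of_isKContact (hK : IsKContact C M) (X : V) : lc X M.ξ = -M.φ X := by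
  rw [← sub_eq_zero]
  refine M.eq_zero_of_forall_g_eq_zero fun Y => ?_
  have hk := hK X Y
  have hm := hlc.2.2 M.ξ X Y
  have hc := M.compat X Y
  have hx := hlc.2.2 X Y M.ξ
  have hy := hlc.2.2 Y X M.ξ
  simp only [lieDerivG, dEta, bracket_eq_sub hlc, M.η_sub, g_sub_left, g_sub_right, g_ξ]
    at hk hc hx hy
  rw [hx, hy] at hc
  rw [M.g_symm (lc X M.ξ)] at hk
  rw [g_sub_left, g_neg_left, g_φ_left, M.g_symm (lc X M.ξ)]
  linear_combination hc + algebraMap ℝ F (1 / 2) * (hk - hm) -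
    M.g Y (lc X M.ξ) * two_mul_algebraMap_half (F := F)

lemma lc_ξ_of_isSasakian (hS : IsSasakian C M lc) (X : V) : lc X M.ξ = -M.φ X := by
  have h := congrArg M.φ (hS X M.ξ)
  rw [M.φ_ξ, hlc.1.zero_right, M.g_ξ, M.η_ξ, zero_sub, map_neg, M.φ_sq, η_lc_ξ hlc, zero_smul,
    add_zero, neg_neg, map_sub, map_smul, M.φ_ξ, smul_zero, zero_sub, one_smul] at h
  exact h

end LeviCivita

/-- The defining properties of the canonical connection `∇̃`. -/
structure IsCanonical (lc Dt : V → V → V) : Prop where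
  isConnection : C.IsConnection Dt
  horizontal : ∀ Z Z', M.η Z = 0 → M.η Z' = 0 →
    Dt Z Z' = lc Z Z' - M.η (lc Z Z') • M.ξ
  reeb : ∀ Z, M.η Z = 0 → Dt M.ξ Z = C.bracket M.ξ Z
  apply_ξ : ∀ X, Dt X M.ξ = 0

namespace IsCanonical

variable {M} {lc Dt : V → V → V} (hD : M.IsCanonical lc Dt)
include hD

lemma apply_add_smul {Z W : V} (hZ : M.η Z = 0) (hW : M.η W = 0) (f k : F) :
    Dt (Z + f • M.ξ) (W + k • M.ξ) = lc Z W - M.η (lc Z W) • M.ξ + f • C.bracket M.ξ W +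
      C.act (Z + f • M.ξ) k • M.ξ := by
  obtain ⟨h1, h2, h3, h4⟩ := hD.isConnection
  rw [h3, h4, hD.apply_ξ, smul_zero, add_zero, h1, h2, hD.horizontal _ _ hZ hW, hD.reeb _ hW]

lemma isKContact_iff (hlc : IsLeviCivita C M lc) : IsKContact C M ↔ MetricCompat C M Dt := by
  constructor
  · intro hK U X Y
    obtain ⟨A, hA, a, rfl⟩ := M.exists_horizontal_add_smul U
    obtain ⟨Z, hZ, f, rfl⟩ := M.exists_horizontal_add_smul X
    obtain ⟨W, hW, k, rfl⟩ := M.exists_horizontal_add_smul Y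
    have hm := hlc.2.2 A Z W
    have hk := hK Z W
    unfold lieDerivG at hk
    rw [hD.apply_add_smul hA hZ, hD.apply_add_smul hA hW]
    simp only [g_add_left, g_add_right, g_sub_left, g_sub_right, g_smul_left, g_smul_right, g_ξ,
      g_ξ_left, M.η_add, M.η_sub, M.η_smul, M.η_ξ, hZ, hW, M.η_bracket_ξ hZ, M.η_bracket_ξ hW,
      C.act_add_left, C.act_smul_left, C.act_add_right, C.act_mul_right, C.act_zero_right, mul_one,
      zero_add]
    linear_combination hm + a * hk
  · intro hm X Y
    obtain ⟨Z, hZ, f, rfl⟩ := M.exists_horizontal_add_smul X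
    obtain ⟨W, hW, k, rfl⟩ := M.exists_horizontal_add_smul Y
    rw [lieDerivG_ξ_add_smul, lieDerivG, hm, hD.reeb _ hZ, hD.reeb _ hW]
    ring

lemma bracket_ξ_φ (hφ : PhiCompat C M Dt) {Z : V} (hZ : M.η Z = 0) :
    C.bracket M.ξ (M.φ Z) = M.φ (C.bracket M.ξ Z) := by
  rw [← hD.reeb _ (M.η_φ Z), hφ, hD.reeb _ hZ]

lemma lc_ξ (hlc : IsLeviCivita C M lc) (hφ : PhiCompat C M Dt) (X : V) : lc X M.ξ = -M.φ X :=
  lc_ξ_of_isKContact hlc (M.isKContact_of_bracket_ξ_φ fun _ hZ => hD.bracket_ξ_φ hφ hZ) X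

lemma phiCompat_of_isSasakian (hlc : IsLeviCivita C M lc) (hS : IsSasakian C M lc) :
    PhiCompat C M Dt := by
  intro U X
  obtain ⟨A, hA, a, rfl⟩ := M.exists_horizontal_add_smul U
  obtain ⟨Z, hZ, f, rfl⟩ := M.exists_horizontal_add_smul X
  have hξ := lc_ξ_of_isSasakian hlc hS
  have hb : C.bracket M.ξ (M.φ Z) = M.φ (C.bracket M.ξ Z) := by
    have h := hS M.ξ Z
    rw [M.g_ξ_left, sub_self, sub_eq_zero] at h
    rw [bracket_eq_sub hlc, bracket_eq_sub hlc, hξ, hξ, h, map_sub, map_neg]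
  have hA' : lc A (M.φ Z) = M.φ (lc A Z) + M.g A Z • M.ξ := by
    have h := hS A Z
    rw [hZ, zero_smul, sub_zero] at h
    rw [← h]
    abel
  have e := hD.apply_add_smul hA (M.η_φ Z) a 0
  rw [zero_smul, add_zero] at e
  rw [M.φ_add_smul_ξ, e, hD.apply_add_smul hA hZ, M.φ_add_smul_ξ, C.act_zero_right, zero_smul,
    add_zero, hb, hA', M.η_add, M.η_smul, M.η_φ, M.η_ξ, map_add, map_sub, map_smul, map_smul,
    M.φ_ξ, smul_zero, mul_one, zero_add, add_sub_cancel_right, sub_zero]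

lemma isSasakian_of_phiCompat (hlc : IsLeviCivita C M lc) (hφ : PhiCompat C M Dt) :
    IsSasakian C M lc := by
  intro X Y
  obtain ⟨A, hA, a, rfl⟩ := M.exists_horizontal_add_smul X
  obtain ⟨Z, hZ, f, rfl⟩ := M.exists_horizontal_add_smul Y
  have hξ := hD.lc_ξ hlc hφ
  have hA' : lc A (M.φ Z) = M.φ (lc A Z) + M.g A Z • M.ξ := by
    have h := hφ A Z
    rw [hD.horizontal _ _ hA (M.η_φ Z), hD.horizontal _ _ hA hZ, η_lc hlc A (M.η_φ Z), hξ,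
      M.g_neg_right, neg_neg, M.g_φ_φ, hZ, zero_mul, sub_zero, M.g_symm, map_sub, map_smul,
      M.φ_ξ, smul_zero, sub_zero, sub_eq_iff_eq_add] at h
    exact h
  have hR : lc M.ξ (M.φ Z) = M.φ (lc M.ξ Z) := by
    have h := hD.bracket_ξ_φ hφ hZ
    rw [bracket_eq_sub hlc, bracket_eq_sub hlc, hξ, hξ, map_sub, map_neg] at h
    exact sub_left_injective h
  obtain ⟨⟨h1, h2, h3, h4⟩, -⟩ := hlc
  rw [M.φ_add_smul_ξ, h3, h4, hξ, h1, h1, h2, h2, hA', hR]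
  simp only [map_add, map_smul, map_neg, M.φ_add_smul_ξ, M.φ_sq, M.φ_ξ, hA, hZ, M.g_add_left,
    M.g_add_right, M.g_smul_left, M.g_smul_right, M.g_ξ, M.g_ξ_left, M.η_ξ, M.η_add, M.η_smul]
  module

lemma eq_tanakaWebster (hlc : IsLeviCivita C M lc) (hφ : PhiCompat C M Dt) (X Y : V) :
    Dt X Y = tanakaWebster C M lc X Y := by
  have hh : hTensor C M X = 0 := by
    obtain ⟨A, hA, a, rfl⟩ := M.exists_horizontal_add_smul X
    rw [hTensor, M.φ_add_smul_ξ, hD.bracket_ξ_φ hφ hA, C.bracket_add_right, C.bracket_smul_right,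
      C.bracket_self, smul_zero, add_zero, M.φ_add_smul_ξ, sub_self, smul_zero]
  rw [tanakaWebster, hh, map_zero, add_zero, add_zero, M.compat]
  obtain ⟨A, hA, a, rfl⟩ := M.exists_horizontal_add_smul X
  obtain ⟨Z, hZ, f, rfl⟩ := M.exists_horizontal_add_smul Y
  have hξ := hD.lc_ξ hlc hφ
  rw [hD.apply_add_smul hA hZ, η_lc hlc A hZ, hξ, M.g_neg_right, M.g_symm Z, M.g_φ_left,
    bracket_eq_sub hlc, hξ]
  obtain ⟨⟨h1, h2, h3, h4⟩, -⟩ := hlc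
  rw [h3, h4, hξ, h1, h2]
  simp only [M.φ_add_smul_ξ, M.g_add_left, M.g_smul_left, M.g_ξ_left, M.η_φ, hA, hZ, M.η_add,
    M.η_smul, M.η_ξ]
  module

end IsCanonical

end ContactMetric

/-- Theorem.  Let `(M, φ, ξ, η, g)` be a contact metric
manifold and `∇̃` the connection defined by `∇̃_Z Z' = (∇̂_Z Z')_D`,
`∇̃_ξ Z = [ξ, Z]`, `∇̃ξ = 0` on sections of `D = ker η`.  Then `M` is
K-contact if and only if `∇̃g = 0`, and `M` is Sasakian if and only if
`∇̃φ = 0`, in which case `∇̃` coincides with the Tanaka-Webster connection. -/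
theorem canonical_contact_connection_kContact_sasakian
    (C : VFCalculus F V) (M : ContactMetric C)
    (lc : V → V → V) (hlc : IsLeviCivita C M lc)
    (Dt : V → V → V) (hconn : C.IsConnection Dt)
    (hdef₁ : ∀ Z Z', M.η Z = 0 → M.η Z' = 0 →
      Dt Z Z' = lc Z Z' - M.η (lc Z Z') • M.ξ)
    (hdef₂ : ∀ Z, M.η Z = 0 → Dt M.ξ Z = C.bracket M.ξ Z)
    (hdef₃ : ∀ X, Dt X M.ξ = 0) :
    (IsKContact C M ↔ MetricCompat C M Dt) ∧
    (IsSasakian C M lc ↔ PhiCompat C M Dt) ∧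
    (PhiCompat C M Dt → ∀ X Y, Dt X Y = tanakaWebster C M lc X Y) := by
  have hD : M.IsCanonical lc Dt := ⟨hconn, hdef₁, hdef₂, hdef₃⟩
  exact ⟨hD.isKContact_iff hlc,
    ⟨hD.phiCompat_of_isSasakian hlc, hD.isSasakian_of_phiCompat hlc⟩,
    hD.eq_tanakaWebster hlc⟩
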